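/- Let f : E^n → ℝ and suppose there are functions f_i : E^{n−1} → ℝ (i = 1,…,n) such that for all x ∈ E^n and all i, 0 ≤ f(x) − f_i(x^{(i)}) ≤ α_i, where x^{(i)} denotes x with its i-th coordinate deleted. Then for all x, x' ∈ E^n, |f(x) − f(x')| ≤ d_α(x, x'), i.e. f is 1-Lipschitz with respect to the α-Hamming distance. -/

import Mathlib

open scoped Classical ENNReal

/-- The `α`-weighted Hamming distance between two points of `Eⁿ`. -/
noncomputable def alphaHamming {E : Type*} {n : ℕ} (α : Fin n → ℝ) (x y : Fin n → E) : ℝ :=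
  ∑ i ∈ Finset.univ.filter fun i => x i ≠ y i, α i

theorem lipschitz_of_increment_condition
    {E : Type*} {n : ℕ} (α : Fin (n + 1) → ℝ) (hα0 : ∀ i, 0 ≤ α i)
    (f : (Fin (n + 1) → E) → ℝ) (g : Fin (n + 1) → (Fin n → E) → ℝ)
    (hcond : ∀ (x : Fin (n + 1) → E) (i : Fin (n + 1)),
      0 ≤ f x - g i (fun j => x (i.succAbove j)) ∧
        f x - g i (fun j => x (i.succAbove j)) ≤ α i) :
    ∀ x x' : Fin (n + 1) → E, |f x - f x'| ≤ alphaHamming α x x' := by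
  intro x x'
  have step : ∀ (y z : Fin (n + 1) → E) (i : Fin (n + 1)), (∀ j, j ≠ i → y j = z j) →
      |f y - f z| ≤ α i := by
    intro y z i h
    have e : (fun j => y (i.succAbove j)) = (fun j => z (i.succAbove j)) := by
      funext j
      exact h _ (Fin.succAbove_ne i j)
    have h1 := hcond y i
    have h2 := hcond z i
    rw [e] at h1
    rw [abs_le]
    constructor <;> linarith [h1.1, h1.2, h2.1, h2.2]
  have key : ∀ s : Finset (Fin (n + 1)),
      |f x - f (fun j => if j ∈ s then x' j else x j)| ≤ ∑ i ∈ s, if x i ≠ x' i then α i else 0 := by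
    intro s
    induction s using Finset.induction_on with
    | empty => simp
    | insert a s ha ih =>
      rw [Finset.sum_insert ha]
      refine (abs_sub_le _ (f (fun j => if j ∈ s then x' j else x j)) _).trans ?_
      rw [add_comm]
      refine add_le_add ?_ ih
      by_cases hx : x a = x' a
      · have e : (fun j => if j ∈ s then x' j else x j) =
            (fun j => if j ∈ insert a s then x' j else x j) := by
          funext j
          by_cases hj : j = a
          · subst hj
            simp [ha, hx]
          · simp [hj]
        rw [e]
        simp [hx]
      · rw [if_pos hx]
        apply step
        intro j hj
        simp [hj]
  have := key Finset.univ
  simp only [Finset.mem_univ, if_true] at this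
  unfold alphaHamming
  rw [Finset.sum_filter]
  exact this
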